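/- Let R be a commutative Noetherian local ring with maximal ideal 𝔪, M a nonzero finitely generated faithful R-module of dimension one and depth zero, n a positive integer with 𝔪^n M ∩ Γ_𝔪(M) = (0), a a parameter of M, and c ∈ R such that b := c a^{n+1} is a parameter of M. Then there is an isomorphism of R-modules Hom_R(R/(a), M/bM) ≅ (c a^n M)/(c a^{n+1} M) ⊕ ((0 :_M a) + c a^{n+1} M)/(c a^{n+1} M), and both summands are nonzero. -/

import Mathlib

/-- The `I`-power-torsion submodule `Γ_I(M) = {x ∈ M | I^k x = 0 for some k}`,
i.e. the zeroth local cohomology of `M` with support in `I`. -/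
def torsionGamma {R : Type*} [CommRing R] (I : Ideal R) (M : Type*) [AddCommGroup M]
    [Module R M] : Submodule R M where
  carrier := {x | ∃ k : ℕ, ∀ r ∈ I ^ k, r • x = (0 : M)}
  zero_mem' := ⟨0, fun r _ => smul_zero r⟩
  add_mem' := by
    rintro x y ⟨k, hk⟩ ⟨l, hl⟩
    refine ⟨k + l, fun r hr => ?_⟩
    have hrk : r ∈ I ^ k := Ideal.pow_le_pow_right (Nat.le_add_right k l) hr
    have hrl : r ∈ I ^ l := Ideal.pow_le_pow_right (Nat.le_add_left l k) hr
    rw [smul_add, hk r hrk, hl r hrl, add_zero]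
  smul_mem' := by
    rintro c x ⟨k, hk⟩
    refine ⟨k, fun r hr => ?_⟩
    rw [smul_smul, mul_comm, ← smul_smul, hk r hr, smul_zero]

/-- The depth of a module: the supremum of the lengths of regular sequences on `M`
consisting of nonunits (for a local ring, elements of the maximal ideal). -/
noncomputable def moduleDepth (R M : Type*) [CommRing R] [AddCommGroup M] [Module R M] : ℕ∞ :=
  sSup {n : ℕ∞ | ∃ rs : List R, (rs.length : ℕ∞) = n ∧ (∀ r ∈ rs, r ∈ nonunits R) ∧
    RingTheory.Sequence.IsRegular M rs}

/-- The (Krull) dimension of a module: the Krull dimension of `R / ann M`. -/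
noncomputable def moduleDim (R M : Type*) [CommRing R] [AddCommGroup M] [Module R M] :
    WithBot ℕ∞ :=
  ringKrullDim (R ⧸ Module.annihilator R M)

/-- A module is Cohen-Macaulay if its depth equals its dimension. -/
def IsCohenMacaulay (R M : Type*) [CommRing R] [AddCommGroup M] [Module R M] : Prop :=
  (moduleDepth R M : WithBot ℕ∞) = moduleDim R M

/-- `a : Fin d → R` is a system of parameters of `M` if `M` has dimension `d`, the `a i`
are nonunits (i.e. lie in the maximal ideal, when `R` is local), and `M/(a)M` has
finite length. -/
def IsSystemOfParameters (R M : Type*) [CommRing R] [AddCommGroup M] [Module R M]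
    {d : ℕ} (a : Fin d → R) : Prop :=
  (∀ i, a i ∈ nonunits R) ∧ moduleDim R M = (d : ℕ∞) ∧
    IsFiniteLength R (M ⧸ (Ideal.span (Set.range a) • (⊤ : Submodule R M)))

/-- An ideal is a parameter ideal of `M` if it is generated by a system of parameters of `M`. -/
def IsParameterIdeal (R M : Type*) [CommRing R] [AddCommGroup M] [Module R M]
    (I : Ideal R) : Prop :=
  ∃ (d : ℕ) (a : Fin d → R), IsSystemOfParameters R M a ∧ I = Ideal.span (Set.range a)

/-- A parameter of a one-dimensional module `M`: a nonunit `a` (i.e. an element of the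
maximal ideal, when `R` is local) such that `M/aM` has finite length. -/
def IsParameter (R M : Type*) [CommRing R] [AddCommGroup M] [Module R M] (a : R) : Prop :=
  a ∈ nonunits R ∧ IsFiniteLength R (M ⧸ (Ideal.span {a} • (⊤ : Submodule R M)))

/-- A module is decomposable if it is the (internal, equivalently external) direct sum of
two nonzero submodules. -/
def IsDecomposable (R M : Type*) [Ring R] [AddCommGroup M] [Module R M] : Prop :=
  ∃ X Y : Submodule R M, X ≠ ⊥ ∧ Y ≠ ⊥ ∧ IsCompl X Y

theorem homIsTorsion {R : Type*} [CommRing R] (I : Ideal R) (N : Type*) [AddCommGroup N]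
    [Module R N] : Module.IsTorsionBySet R ((R ⧸ I) →ₗ[R] N) I := by
  intro φ a
  refine LinearMap.ext fun x => ?_
  obtain ⟨r, rfl⟩ := Ideal.Quotient.mk_surjective x
  have hx : (a : R) • (Ideal.Quotient.mk I r : R ⧸ I) = 0 := by
    have h1 : (a : R) • (Ideal.Quotient.mk I r : R ⧸ I) = Ideal.Quotient.mk I ((a : R) * r) :=
      rfl
    rw [h1, Ideal.Quotient.eq_zero_iff_mem]
    exact I.mul_mem_right r a.2
  calc ((a : R) • φ) (Ideal.Quotient.mk I r)
      = (a : R) • φ (Ideal.Quotient.mk I r) := rfl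
    _ = φ ((a : R) • (Ideal.Quotient.mk I r : R ⧸ I)) := (map_smul φ _ _).symm
    _ = 0 := by rw [hx, map_zero]

/-- The canonical `R ⧸ I`-module structure on `Hom_R(R ⧸ I, N)`. -/
noncomputable def quotHomModule {R : Type*} [CommRing R] (I : Ideal R) (N : Type*)
    [AddCommGroup N] [Module R N] : Module (R ⧸ I) ((R ⧸ I) →ₗ[R] N) :=
  (homIsTorsion I N).module

open IsLocalRing

theorem aux_finlen {R : Type*} [CommRing R] [IsLocalRing R] {M : Type*} [AddCommGroup M]
    [Module R M] (h : IsFiniteLength R M) :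
    ∃ k : ℕ, ∀ r ∈ maximalIdeal R ^ k, ∀ x : M, r • x = 0 := by
  induction h with
  | of_subsingleton => exact ⟨0, fun r _ x => Subsingleton.elim _ _⟩
  | @of_simple_quotient M _ _ N hs h ih =>
    obtain ⟨k, hk⟩ := ih
    refine ⟨k + 1, ?_⟩
    have hmax : (Module.annihilator R (M ⧸ N)).IsMaximal := IsSimpleModule.annihilator_isMaximal
    have hm := IsLocalRing.eq_maximalIdeal hmax
    intro r hr x
    rw [pow_succ] at hr
    refine Submodule.mul_induction_on hr ?_ ?_
    · intro s hs t ht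
      rw [← hm, Module.mem_annihilator] at ht
      have h1 : t • x ∈ N := by
        have := ht (N.mkQ x)
        rwa [← map_smul, Submodule.mkQ_apply, Submodule.Quotient.mk_eq_zero] at this
      have h2 := hk s hs ⟨t • x, h1⟩
      rw [mul_smul]
      exact congrArg Subtype.val h2
    · intro s t hs ht
      rw [add_smul, hs, ht, add_zero]

theorem aux_smul_eq {R M : Type*} [CommRing R] [AddCommGroup M] [Module R M] (b : R) :
    Ideal.span {b} • (⊤ : Submodule R M) = Submodule.map (LinearMap.lsmul R M b) ⊤ := by
  ext x
  simp [Submodule.ideal_span_singleton_smul, Submodule.mem_smul_pointwise_iff_exists]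

theorem aux_param {R M : Type*} [CommRing R] [IsNoetherianRing R]
    [IsLocalRing R] [AddCommGroup M] [Module R M] [Module.Finite R M]
    (hfaith : Module.annihilator R M = ⊥) (a : R) (ha : IsParameter R M a) :
    ∃ k : ℕ, maximalIdeal R ^ k ≤ Ideal.span {a} := by
  obtain ⟨k, hk⟩ := aux_finlen ha.2
  apply Ideal.exists_pow_le_of_le_radical_of_fg _ (IsNoetherian.noetherian _)
  intro r hr
  have hrk : ∀ x : M, r ^ k • x ∈ Ideal.span {a} • (⊤ : Submodule R M) := by
    intro x
    have := hk (r ^ k) (Ideal.pow_mem_pow hr k) (Submodule.mkQ _ x)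
    rwa [← map_smul, Submodule.mkQ_apply, Submodule.Quotient.mk_eq_zero] at this
  obtain ⟨p, hp, -, h1, h2⟩ :=
    LinearMap.exists_monic_and_natDegree_eq_and_coeff_mem_pow_and_aeval_eq_zero R
      (LinearMap.lsmul R M (r ^ k)) (Ideal.span {a}) (by
        rintro _ ⟨x, rfl⟩; exact hrk x)
  have h3 : p.eval (r ^ k) = 0 := by
    have : p.eval (r ^ k) ∈ Module.annihilator R M := by
      rw [Module.mem_annihilator]
      intro x
      have e : LinearMap.lsmul R M (r ^ k) = algebraMap R (Module.End R M) (r ^ k) := by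
        rfl
      rw [e, Polynomial.aeval_algebraMap_apply] at h2
      have := LinearMap.congr_fun h2 x
      simpa using this
    rw [hfaith] at this
    simpa using this
  have h4 : (r ^ k) ^ p.natDegree ∈ Ideal.span {a} := by
    rw [Polynomial.eval_eq_sum_range, Finset.sum_range_succ, hp.coeff_natDegree, one_mul] at h3
    rw [eq_neg_of_add_eq_zero_right h3]
    refine neg_mem (sum_mem fun i hi => Ideal.mul_mem_right _ _ ?_)
    have := h1 i
    refine Ideal.pow_le_self ?_ this
    have := Finset.mem_range.1 hi
    omega
  rw [← pow_mul] at h4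
  exact ⟨_, h4⟩

theorem aux_nontriv {R M : Type*} [CommRing R] [AddCommGroup M] [Module R M]
    (P N : Submodule R M) (h : ¬ P ≤ N) : Nontrivial (↥P ⧸ Submodule.comap P.subtype N) := by
  rw [Submodule.Quotient.nontrivial_iff]
  intro h'
  exact h (Submodule.comap_subtype_eq_top.1 h')

theorem aux_iso {R M : Type*} [CommRing R] [AddCommGroup M] [Module R M]
    (a : R) (P Q N N' : Submodule R M) (hN : N' = N) (hNQ : N ≤ Q) (hd : P ⊓ Q ≤ N)
    (hmem : ∀ x : M, a • x ∈ N ↔ x ∈ P ⊔ Q) :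
    Nonempty (((R ⧸ Ideal.span {a}) →ₗ[R] (M ⧸ N')) ≃ₗ[R]
      ((↥P ⧸ Submodule.comap P.subtype N) × (↥Q ⧸ Submodule.comap Q.subtype N))) := by
  subst hN
  let ev : ((R ⧸ Ideal.span {a}) →ₗ[R] (M ⧸ N')) →ₗ[R] M ⧸ N' :=
    LinearMap.applyₗ (1 : R ⧸ Ideal.span {a})
  let fP : (↥P ⧸ Submodule.comap P.subtype N') →ₗ[R] M ⧸ N' :=
    Submodule.mapQ _ _ P.subtype le_rfl
  let fQ : (↥Q ⧸ Submodule.comap Q.subtype N') →ₗ[R] M ⧸ N' :=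
    Submodule.mapQ _ _ Q.subtype le_rfl
  let f := fP.coprod fQ
  have hev : Function.Injective ev := by
    intro φ ψ h
    ext
    exact h
  have hf : Function.Injective f := by
    rw [← LinearMap.ker_eq_bot, LinearMap.ker_eq_bot']
    rintro ⟨p, q⟩ h
    obtain ⟨p, rfl⟩ := Submodule.Quotient.mk_surjective _ p
    obtain ⟨q, rfl⟩ := Submodule.Quotient.mk_surjective _ q
    have h' : (Submodule.Quotient.mk ((p : M) + q) : M ⧸ N') = 0 := h
    rw [Submodule.Quotient.mk_eq_zero] at h'
    have hp : (p : M) ∈ N' := by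
      refine hd ⟨p.2, ?_⟩
      have := Q.sub_mem (hNQ h') q.2
      simpa using this
    have hq : (q : M) ∈ N' := by
      have := N'.sub_mem h' hp
      simpa using this
    ext1
    · exact (Submodule.Quotient.mk_eq_zero _).2 hp
    · exact (Submodule.Quotient.mk_eq_zero _).2 hq
  have hr : LinearMap.range ev = LinearMap.range f := by
    apply le_antisymm
    · rintro _ ⟨φ, rfl⟩
      obtain ⟨x, hx⟩ := Submodule.Quotient.mk_surjective _ (ev φ)
      rw [← hx]
      have : a • x ∈ N' := by
        rw [← Submodule.Quotient.mk_eq_zero, Submodule.Quotient.mk_smul, hx]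
        change a • φ 1 = 0
        exact LinearMap.congr_fun (@homIsTorsion R _ (Ideal.span {a}) (M ⧸ N') _ _ φ
          ⟨a, Ideal.mem_span_singleton_self a⟩) 1
      rw [hmem] at this
      obtain ⟨p, hp, q, hq, rfl⟩ := Submodule.mem_sup.1 this
      exact ⟨(Submodule.Quotient.mk ⟨p, hp⟩, Submodule.Quotient.mk ⟨q, hq⟩), rfl⟩
    · rintro _ ⟨⟨p, q⟩, rfl⟩
      obtain ⟨p, rfl⟩ := Submodule.Quotient.mk_surjective _ p
      obtain ⟨q, rfl⟩ := Submodule.Quotient.mk_surjective _ q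
      have h0 : a • ((p : M) + q) ∈ N' :=
        (hmem _).2 (Submodule.add_mem_sup p.2 q.2)
      refine ⟨Submodule.liftQ _ (LinearMap.toSpanSingleton R _
        (Submodule.Quotient.mk ((p : M) + q))) ?_, ?_⟩
      · rw [Ideal.span_le, Set.singleton_subset_iff]
        change a • (Submodule.Quotient.mk ((p : M) + q) : M ⧸ N') = 0
        rw [← Submodule.Quotient.mk_smul, Submodule.Quotient.mk_eq_zero]
        exact h0
      · change (1 : R) • (Submodule.Quotient.mk ((p : M) + q) : M ⧸ N') = _
        rw [one_smul]
        rfl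
  exact ⟨(LinearEquiv.ofInjective ev hev).trans
    ((LinearEquiv.ofEq _ _ hr).trans (LinearEquiv.ofInjective f hf).symm)⟩

/-- With `M` nonzero finitely generated faithful of dimension one and depth
zero, `𝔪^n M ∩ Γ_𝔪(M) = 0`, `a` a parameter of `M` and `b = c a^(n+1)` a parameter of `M`,
one has `Hom_R(R/(a), M/bM) ≅ (c a^n M)/(c a^(n+1) M) ⊕ ((0 :_M a) + c a^(n+1) M)/(c a^(n+1) M)`
as `R`-modules, and both summands are nonzero. -/
theorem hom_dim_one_decomposition {R M : Type*} [CommRing R] [IsNoetherianRing R]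
    [IsLocalRing R] [AddCommGroup M] [Module R M] [Module.Finite R M] [Nontrivial M]
    (hfaith : Module.annihilator R M = ⊥)
    (hdim : moduleDim R M = (1 : WithBot ℕ∞)) (hdepth : moduleDepth R M = 0)
    (n : ℕ) (hn : 0 < n)
    (hGamma : ((maximalIdeal R ^ n) • (⊤ : Submodule R M)) ⊓ torsionGamma (maximalIdeal R) M = ⊥)
    (a : R) (ha : IsParameter R M a)
    (c b : R) (hbdef : b = c * a ^ (n + 1)) (hb : IsParameter R M b) :
    Nonempty (((R ⧸ Ideal.span {a}) →ₗ[R] (M ⧸ (Ideal.span {b} • (⊤ : Submodule R M)))) ≃ₗ[R]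
        ((↥(Submodule.map (LinearMap.lsmul R M (c * a ^ n)) ⊤) ⧸
            Submodule.comap (Submodule.map (LinearMap.lsmul R M (c * a ^ n)) ⊤).subtype
              (Submodule.map (LinearMap.lsmul R M b) ⊤)) ×
          (↥(LinearMap.ker (LinearMap.lsmul R M a) ⊔
              Submodule.map (LinearMap.lsmul R M b) ⊤) ⧸
            Submodule.comap (LinearMap.ker (LinearMap.lsmul R M a) ⊔
              Submodule.map (LinearMap.lsmul R M b) ⊤).subtype
              (Submodule.map (LinearMap.lsmul R M b) ⊤)))) ∧
    Nontrivial (↥(Submodule.map (LinearMap.lsmul R M (c * a ^ n)) ⊤) ⧸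
        Submodule.comap (Submodule.map (LinearMap.lsmul R M (c * a ^ n)) ⊤).subtype
          (Submodule.map (LinearMap.lsmul R M b) ⊤)) ∧
    Nontrivial (↥(LinearMap.ker (LinearMap.lsmul R M a) ⊔
        Submodule.map (LinearMap.lsmul R M b) ⊤) ⧸
        Submodule.comap (LinearMap.ker (LinearMap.lsmul R M a) ⊔
          Submodule.map (LinearMap.lsmul R M b) ⊤).subtype
          (Submodule.map (LinearMap.lsmul R M b) ⊤)) := by
  have ham : a ∈ maximalIdeal R := ha.1
  -- (0 :_M a) is contained in Γ
  have hker : LinearMap.ker (LinearMap.lsmul R M a) ≤ torsionGamma (maximalIdeal R) M := by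
    obtain ⟨k, hk⟩ := aux_param hfaith a ha
    intro z hz
    refine ⟨k, fun r hr => ?_⟩
    obtain ⟨s, rfl⟩ := Ideal.mem_span_singleton'.1 (hk hr)
    have hz' : a • z = 0 := hz
    rw [mul_smul, hz', smul_zero]
  have hP : Submodule.map (LinearMap.lsmul R M (c * a ^ n)) ⊤ ≤
      maximalIdeal R ^ n • (⊤ : Submodule R M) := by
    rintro _ ⟨x, -, rfl⟩
    exact Submodule.smul_mem_smul (Ideal.mul_mem_left _ _ (Ideal.pow_mem_pow ham n)) trivial
  have hNP : Submodule.map (LinearMap.lsmul R M b) ⊤ ≤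
      Submodule.map (LinearMap.lsmul R M (c * a ^ n)) ⊤ := by
    rintro _ ⟨x, -, rfl⟩
    refine ⟨a • x, trivial, ?_⟩
    simp only [LinearMap.lsmul_apply, hbdef, smul_smul]
    congr 1
    ring
  have hz0 : ∀ z ∈ Submodule.map (LinearMap.lsmul R M (c * a ^ n)) ⊤,
      z ∈ LinearMap.ker (LinearMap.lsmul R M a) → z = 0 := by
    intro z h1 h2
    have : z ∈ (⊥ : Submodule R M) := hGamma ▸ ⟨hP h1, hker h2⟩
    simpa using this
  refine ⟨?_, ?_, ?_⟩
  · refine aux_iso a _ _ _ _ (aux_smul_eq b) le_sup_right ?_ ?_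
    · rintro x ⟨hx1, hx2⟩
      obtain ⟨z, hz, y, hy, rfl⟩ := Submodule.mem_sup.1 hx2
      have : z = 0 := by
        refine hz0 z ?_ hz
        have := Submodule.sub_mem _ hx1 (hNP hy)
        simpa using this
      rw [this, zero_add]
      exact hy
    · intro x
      constructor
      · rintro ⟨y, -, hy⟩
        have hy' : b • y = a • x := hy
        have e : x = (c * a ^ n) • y + (x - (c * a ^ n) • y) := by abel
        rw [e]
        refine Submodule.add_mem_sup ⟨y, trivial, rfl⟩ (Submodule.mem_sup_left ?_)
        rw [LinearMap.mem_ker, LinearMap.lsmul_apply, smul_sub, ← hy', smul_smul, hbdef, sub_eq_zero]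
        congr 1
        ring
      · intro hx
        obtain ⟨p, ⟨u, -, rfl⟩, q, hq, rfl⟩ := Submodule.mem_sup.1 hx
        obtain ⟨z, hz, y, hy, rfl⟩ := Submodule.mem_sup.1 hq
        have hz' : a • z = 0 := hz
        rw [smul_add, smul_add, hz', zero_add]
        refine Submodule.add_mem _ ⟨u, trivial, ?_⟩ (Submodule.smul_mem _ _ hy)
        simp only [LinearMap.lsmul_apply, hbdef, smul_smul]
        congr 1
        ring
  · apply aux_nontriv
    intro hle
    have hbot : Submodule.map (LinearMap.lsmul R M (c * a ^ n)) ⊤ = ⊥ := by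
      refine Submodule.eq_bot_of_le_smul_of_le_jacobson_bot (maximalIdeal R) _
        (IsNoetherian.noetherian _) ?_ (IsLocalRing.maximalIdeal_le_jacobson _)
      intro x hx
      obtain ⟨y, -, rfl⟩ := hle hx
      have e : (LinearMap.lsmul R M b) y = a • ((c * a ^ n) • y) := by
        simp only [LinearMap.lsmul_apply, hbdef, smul_smul]
        congr 1
        ring
      rw [e]
      exact Submodule.smul_mem_smul ham ⟨y, trivial, rfl⟩
    have hb0 : b = 0 := by
      have : b ∈ Module.annihilator R M := by
        rw [Module.mem_annihilator]
        intro m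
        have h1 : b • m ∈ (⊥ : Submodule R M) := hbot ▸ hNP ⟨m, trivial, rfl⟩
        simpa using h1
      rw [hfaith] at this
      simpa using this
    obtain ⟨k, hk⟩ := aux_param hfaith b hb
    have hdim0 : Ring.KrullDimLE 0 R := by
      apply Ring.KrullDimLE.mk₀
      intro I hI
      have : maximalIdeal R ≤ I := by
        apply hI.le_of_pow_le (n := k)
        refine hk.trans ?_
        simp [hb0]
      rw [← (IsLocalRing.maximalIdeal.isMaximal R).eq_of_le hI.ne_top this]
      exact IsLocalRing.maximalIdeal.isMaximal R
    unfold moduleDim at hdim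
    rw [hfaith, ringKrullDim_eq_of_ringEquiv (RingEquiv.quotientBot R)] at hdim
    have := (Ring.krullDimLE_iff (n := 0) (R := R)).1 hdim0
    rw [hdim] at this
    norm_num at this
  · apply aux_nontriv
    intro hle
    have hreg : IsSMulRegular M a := by
      rw [isSMulRegular_iff_right_eq_zero_of_smul]
      intro z hz
      exact hz0 z (hNP (hle (Submodule.mem_sup_left hz))) hz
    have hr : RingTheory.Sequence.IsRegular M [a] := by
      rw [IsLocalRing.isRegular_iff_isWeaklyRegular_of_subset_maximalIdeal (by simpa using ham),
        RingTheory.Sequence.isWeaklyRegular_singleton_iff]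
      exact hreg
    have h1 : (1 : ℕ∞) ≤ moduleDepth R M := by
      apply le_sSup
      exact ⟨[a], by simp, by simpa using ham, hr⟩
    rw [hdepth] at h1
    norm_num at h1
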